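/- arXiv:2509.10290 — 6 statements merged into one kernel-verified Lean document; each statement's English description precedes it below -/
import Mathlib

section
/- Let t, x, y ≥ 0 and let t̄, x̄, ȳ > 0 be reference points. Then t·√(x·y) ≥ (√x̄ + √ȳ)·(L(t,√x; t̄,√x̄) + L(t,√y; t̄,√ȳ)) − (1/2)·((√x̄ + √ȳ)²·t + U(t,x; t̄,x̄) + U(t,y; t̄,ȳ)), and equality holds at (t,x,y) = (t̄,x̄,ȳ), where the right-hand side then equals t̄·√(x̄·ȳ). That is, this expression is a global lower bound of t·√(x·y) tight at the reference point. -/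
/-- The quadratic concave surrogate `L(u,v; ū,v̄)` used in the SCA. -/
noncomputable def Lsur (u v ub vb : ℝ) : ℝ :=
  (ub + vb) * (u + v) - (1 / 2) * ((ub + vb) ^ 2 + u ^ 2 + v ^ 2)

/-- The quadratic convex surrogate `U(u,v; ū,v̄)` (requires `ū, v̄ > 0`). -/
noncomputable def Usur (u v ub vb : ℝ) : ℝ :=
  (vb / (2 * ub)) * u ^ 2 + (ub / (2 * vb)) * v ^ 2

/-- The lower surrogate of `t·√(x·y)` built from `L` and `U` around `(t̄,x̄,ȳ)`. -/
noncomputable def Ltriple (t x y tb xb yb : ℝ) : ℝ :=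
  (Real.sqrt xb + Real.sqrt yb) *
      (Lsur t (Real.sqrt x) tb (Real.sqrt xb) + Lsur t (Real.sqrt y) tb (Real.sqrt yb)) -
    (1 / 2) * ((Real.sqrt xb + Real.sqrt yb) ^ 2 * t + Usur t x tb xb + Usur t y tb yb)

theorem Lsur_le_mul (u v ub vb : ℝ) : Lsur u v ub vb ≤ u * v := by
  unfold Lsur
  nlinarith [sq_nonneg (ub + vb - (u + v))]

theorem Lsur_self (u v : ℝ) : Lsur u v u v = u * v := by
  unfold Lsur
  ring

theorem mul_le_Usur (u v : ℝ) {ub vb : ℝ} (hu : 0 < ub) (hv : 0 < vb) :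
    u * v ≤ Usur u v ub vb := by
  have h : Usur u v ub vb - u * v = (vb * u - ub * v) ^ 2 / (2 * ub * vb) := by
    unfold Usur
    field_simp
    ring
  have : 0 ≤ (vb * u - ub * v) ^ 2 / (2 * ub * vb) := by positivity
  linarith

theorem Usur_self {u v : ℝ} (hu : 0 < u) (hv : 0 < v) : Usur u v u v = u * v := by
  unfold Usur
  field_simp
  ring

/-- the surrogate `Ltriple` is a global lower bound of `t·√(x·y)`
for `t, x, y ≥ 0` and reference points `t̄, x̄, ȳ > 0`, and it is tight at the
reference point, where it equals `t̄·√(x̄·ȳ)`. -/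
theorem triple_product_lower_bound (t x y tb xb yb : ℝ)
    (ht : 0 ≤ t) (hx : 0 ≤ x) (hy : 0 ≤ y)
    (htb : 0 < tb) (hxb : 0 < xb) (hyb : 0 < yb) :
    t * Real.sqrt (x * y) ≥ Ltriple t x y tb xb yb ∧
    Ltriple tb xb yb tb xb yb = tb * Real.sqrt (xb * yb) := by
  have hS : 0 ≤ √xb + √yb := by positivity
  constructor
  · have hL := mul_le_mul_of_nonneg_left
      (add_le_add (Lsur_le_mul t √x tb √xb) (Lsur_le_mul t √y tb √yb)) hS
    have hUx := mul_le_Usur t x htb hxb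
    have hUy := mul_le_Usur t y htb hyb
    have hsq := mul_nonneg ht (sq_nonneg (√x + √y - (√xb + √yb)))
    have hx2 : t * √x ^ 2 = t * x := by rw [Real.sq_sqrt hx]
    have hy2 : t * √y ^ 2 = t * y := by rw [Real.sq_sqrt hy]
    rw [Real.sqrt_mul hx, ge_iff_le]
    unfold Ltriple
    linarith
  · have hx2 : tb * √xb ^ 2 = tb * xb := by rw [Real.sq_sqrt hxb.le]
    have hy2 : tb * √yb ^ 2 = tb * yb := by rw [Real.sq_sqrt hyb.le]
    rw [Real.sqrt_mul hxb.le]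
    unfold Ltriple
    rw [Lsur_self, Lsur_self, Usur_self htb hxb, Usur_self htb hyb]
    linarith
end

section
/- Let t, x, y ≥ 0 and let t̄, x̄, ȳ > 0 be reference points. Then t·√(x·y) ≤ (1/2)·√(ȳ/x̄)·U(t,x; t̄,x̄) + (1/2)·√(x̄/ȳ)·U(t,y; t̄,ȳ), and equality holds at (t,x,y) = (t̄,x̄,ȳ), where the right-hand side then equals t̄·√(x̄·ȳ). That is, this expression is a global upper bound of t·√(x·y) tight at the reference point. -/
/-- The upper surrogate of `t·√(x·y)` built from `U` around `(t̄,x̄,ȳ)`. -/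
noncomputable def Utriple (t x y tb xb yb : ℝ) : ℝ :=
  (1 / 2) * Real.sqrt (yb / xb) * Usur t x tb xb +
    (1 / 2) * Real.sqrt (xb / yb) * Usur t y tb yb

theorem Usur_sqrt {x y a b : ℝ} (hx : 0 ≤ x) (hy : 0 ≤ y) (ha : 0 ≤ a) (hb : 0 ≤ b) :
    Usur √x √y √a √b = 1 / 2 * √(b / a) * x + 1 / 2 * √(a / b) * y := by
  rw [Usur, Real.sq_sqrt hx, Real.sq_sqrt hy, Real.sqrt_div hb, Real.sqrt_div ha]
  ring

/-- the surrogate `Utriple` is a global upper bound of `t·√(x·y)`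
for `t, x, y ≥ 0` and reference points `t̄, x̄, ȳ > 0`, and it is tight at the
reference point, where it equals `t̄·√(x̄·ȳ)`. -/
theorem triple_product_upper_bound (t x y tb xb yb : ℝ)
    (ht : 0 ≤ t) (hx : 0 ≤ x) (hy : 0 ≤ y)
    (htb : 0 < tb) (hxb : 0 < xb) (hyb : 0 < yb) :
    t * Real.sqrt (x * y) ≤ Utriple t x y tb xb yb ∧
    Utriple tb xb yb tb xb yb = tb * Real.sqrt (xb * yb) := by
  have hsa := Real.sqrt_pos.2 hxb
  have hsb := Real.sqrt_pos.2 hyb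
  constructor
  · calc t * √(x * y) = t * (√x * √y) := by rw [Real.sqrt_mul hx]
      _ ≤ t * Usur √x √y √xb √yb := by
        gcongr
        exact mul_le_Usur _ _ hsa hsb
      _ = 1 / 2 * √(yb / xb) * (t * x) + 1 / 2 * √(xb / yb) * (t * y) := by
        rw [Usur_sqrt hx hy hxb.le hyb.le]
        ring
      _ ≤ Utriple t x y tb xb yb := by
        unfold Utriple
        gcongr
        · exact mul_le_Usur _ _ htb hxb
        · exact mul_le_Usur _ _ htb hyb
  · calc Utriple tb xb yb tb xb yb = tb * Usur √xb √yb √xb √yb := by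
          rw [Utriple, Usur_self htb hxb, Usur_self htb hyb,
            Usur_sqrt hxb.le hyb.le hxb.le hyb.le]
          ring
      _ = tb * √(xb * yb) := by rw [Usur_self hsa hsb, Real.sqrt_mul hxb.le]
end

section
/- Let x, y, x̄, ȳ be positive real numbers and define A = ln(1 + x̄/ȳ) + 2x̄/(x̄+ȳ), B = x̄²/(x̄+ȳ), and C = x̄/((x̄+ȳ)·ȳ). Then ln(1 + x/y) ≥ A − B/x − C·y, with equality when (x,y) = (x̄,ȳ). That is, A − B/x − C·y is a global lower bound of ln(1 + x/y) that is tight at the reference point (x̄,ȳ). -/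
/-- Weighted tangent-line bound for the difference of two values of `log (1 + x / y)`. -/
theorem log_one_add_div_sub_le {x y a b : ℝ}
    (hx : 0 < x) (hy : 0 < y) (ha : 0 < a) (hb : 0 < b) :
    Real.log (1 + a / b) - Real.log (1 + x / y) ≤ a / (a + b) * (a / x + y / b - 2) := by
  have hs : 0 < a + b := add_pos ha hb
  have hz : 0 < x + y := add_pos hx hy
  have log_one_add_div {u v : ℝ} (hu : 0 < u) (hv : 0 < v) :
      Real.log (1 + u / v) = Real.log (u + v) - Real.log v := by
    rw [← Real.log_div (add_pos hu hv).ne' hv.ne']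
    congr 1
    field_simp
    ring
  have log_sub_le {u v : ℝ} (hu : 0 < u) (hv : 0 < v) :
      Real.log u - Real.log v ≤ u / v - 1 := by
    rw [← Real.log_div hu.ne' hv.ne']
    exact Real.log_le_sub_one_of_pos (div_pos hu hv)
  have hsx := log_sub_le (mul_pos hs hx) (mul_pos ha hz)
  have hsy := log_sub_le (mul_pos hs hy) (mul_pos hb hz)
  rw [Real.log_mul hs.ne' hx.ne', Real.log_mul ha.ne' hz.ne'] at hsx
  rw [Real.log_mul hs.ne' hy.ne', Real.log_mul hb.ne' hz.ne'] at hsy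
  have hsum : a * ((a + b) * x / (a * (x + y)) - 1) +
      b * ((a + b) * y / (b * (x + y)) - 1) = 0 := by
    field_simp
    ring
  rw [log_one_add_div ha hb, log_one_add_div hx hy, div_mul_eq_mul_div, le_div_iff₀ hs]
  linarith [mul_le_mul_of_nonneg_left hsx ha.le, mul_le_mul_of_nonneg_left hsy hb.le,
    mul_le_mul_of_nonneg_left (log_sub_le hy hb) ha.le,
    mul_le_mul_of_nonneg_left (log_sub_le ha hx) ha.le]

/-- concave lower bound of the rate function `ln(1 + x/y)` around a
reference point `(x̄, ȳ)`: with `A = ln(1 + x̄/ȳ) + 2x̄/(x̄+ȳ)`, `B = x̄²/(x̄+ȳ)`,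
`C = x̄/((x̄+ȳ)·ȳ)`, one has `ln(1 + x/y) ≥ A − B/x − C·y`, with equality at
`(x, y) = (x̄, ȳ)`. -/
theorem rate_lower_bound (x y xb yb : ℝ)
    (hx : 0 < x) (hy : 0 < y) (hxb : 0 < xb) (hyb : 0 < yb) :
    Real.log (1 + x / y) ≥
      (Real.log (1 + xb / yb) + 2 * xb / (xb + yb)) -
        (xb ^ 2 / (xb + yb)) / x - (xb / ((xb + yb) * yb)) * y ∧
    Real.log (1 + xb / yb) =
      (Real.log (1 + xb / yb) + 2 * xb / (xb + yb)) -
        (xb ^ 2 / (xb + yb)) / xb - (xb / ((xb + yb) * yb)) * yb := by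
  refine ⟨?_, by field_simp; ring⟩
  have h := log_one_add_div_sub_le hx hy hxb hyb
  have e : xb / (xb + yb) * (xb / x + y / yb - 2) =
      (xb ^ 2 / (xb + yb)) / x + (xb / ((xb + yb) * yb)) * y - 2 * xb / (xb + yb) := by
    field_simp
  linarith
end

section
/- Let x, y, x̄, ȳ be positive real numbers and define Â = ln(1 + x̄/ȳ) − x̄/(x̄+ȳ), B̂ = ȳ/(x̄+ȳ), and Ĉ = 1/x̄. Then ln(1 + x/y) ≤ Â + (1/2)·B̂·(Ĉ·x²/y + (1/Ĉ)·(1/y)), with equality when (x,y) = (x̄,ȳ). That is, this expression is a global upper bound of ln(1 + x/y) that is tight at the reference point (x̄,ȳ). -/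
/-- convex upper bound of the rate function `ln(1 + x/y)` around a
reference point `(x̄, ȳ)`: with `Â = ln(1 + x̄/ȳ) − x̄/(x̄+ȳ)`, `B̂ = ȳ/(x̄+ȳ)`,
`Ĉ = 1/x̄`, one has `ln(1 + x/y) ≤ Â + (1/2)·B̂·(Ĉ·x²/y + (1/Ĉ)·(1/y))`, with
equality at `(x, y) = (x̄, ȳ)`. -/
theorem rate_upper_bound (x y xb yb : ℝ)
    (hx : 0 < x) (hy : 0 < y) (hxb : 0 < xb) (hyb : 0 < yb) :
    Real.log (1 + x / y) ≤
      (Real.log (1 + xb / yb) - xb / (xb + yb)) +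
        (1 / 2) * (yb / (xb + yb)) *
          ((1 / xb) * x ^ 2 / y + (1 / (1 / xb)) * (1 / y)) ∧
    Real.log (1 + xb / yb) =
      (Real.log (1 + xb / yb) - xb / (xb + yb)) +
        (1 / 2) * (yb / (xb + yb)) *
          ((1 / xb) * xb ^ 2 / yb + (1 / (1 / xb)) * (1 / yb)) := by
  have hB : 0 < yb / (xb + yb) := by positivity
  constructor
  · have hu : 0 < 1 + x / y := by positivity
    have hv : 0 < 1 + xb / yb := by positivity
    have htangent : Real.log (1 + x / y) - Real.log (1 + xb / yb) ≤
        yb / (xb + yb) * (x / y) - xb / (xb + yb) := by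
      rw [← Real.log_div hu.ne' hv.ne']
      refine (Real.log_le_sub_one_of_pos (div_pos hu hv)).trans_eq ?_
      have hs : yb + xb ≠ 0 := by positivity
      field_simp
      ring
    have hamgm : x / y ≤ (1 / 2) * ((1 / xb) * x ^ 2 / y + (1 / (1 / xb)) * (1 / y)) := by
      have hsq : (1 / 2) * ((1 / xb) * x ^ 2 / y + (1 / (1 / xb)) * (1 / y)) - x / y =
          (x - xb) ^ 2 / (2 * xb * y) := by
        field_simp
        ring
      have : 0 ≤ (x - xb) ^ 2 / (2 * xb * y) := by positivity
      linarith
    have hmul := mul_le_mul_of_nonneg_left hamgm hB.le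
    linarith
  · field_simp
    ring
end

section
/- Let x, y, x̄, ȳ be positive real numbers and define A = ln(1 + x̄/ȳ) + 2x̄/(x̄+ȳ), B = x̄²/(x̄+ȳ), and C = x̄/((x̄+ȳ)·ȳ). If x' and y' are real numbers with 0 < x' ≤ x and y' ≥ y, then ln(1 + x/y) ≥ A − B/x' − C·y'. In particular, replacing the numerator of the SINR by any positive lower bound and the denominator by any upper bound preserves the concave lower bound of the rate. -/
/-- composite rate lower bound. With `A = ln(1 + x̄/ȳ) + 2x̄/(x̄+ȳ)`,
`B = x̄²/(x̄+ȳ)`, `C = x̄/((x̄+ȳ)·ȳ)`, if `0 < x' ≤ x` and `y' ≥ y`, then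
`ln(1 + x/y) ≥ A − B/x' − C·y'`. -/
theorem composite_rate_lower_bound (x y xb yb x' y' : ℝ)
    (hx : 0 < x) (hy : 0 < y) (hxb : 0 < xb) (hyb : 0 < yb)
    (hx' : 0 < x') (hx'x : x' ≤ x) (hy'y : y' ≥ y) :
    Real.log (1 + x / y) ≥
      (Real.log (1 + xb / yb) + 2 * xb / (xb + yb)) -
        (xb ^ 2 / (xb + yb)) / x' - (xb / ((xb + yb) * yb)) * y' := by
  have hs : 0 < xb + yb := by positivity
  set z := (x / xb) * (yb / y) with hz
  have hz0 : 0 < z := by positivity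
  have hconc : xb / (xb + yb) * Real.log z ≤
      Real.log (xb / (xb + yb) * z + yb / (xb + yb)) := by
    have h := strictConcaveOn_log_Ioi.concaveOn.2 (Set.mem_Ioi.2 hz0)
      (Set.mem_Ioi.2 one_pos) (div_pos hxb hs).le (div_pos hyb hs).le
      (by field_simp)
    simpa using h
  have hratio : 1 + x / y = (1 + xb / yb) * (xb / (xb + yb) * z + yb / (xb + yb)) := by
    rw [hz]
    field_simp
    ring
  have hlog : Real.log (1 + x / y) = Real.log (1 + xb / yb) +
      Real.log (xb / (xb + yb) * z + yb / (xb + yb)) := by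
    rw [hratio, Real.log_mul (by positivity) (by positivity)]
  have hlogz : 2 - xb / x' - y' / yb ≤ Real.log z := by
    have h1 := Real.one_sub_inv_le_log_of_pos (div_pos hx hxb)
    have h2 := Real.one_sub_inv_le_log_of_pos (div_pos hyb hy)
    rw [inv_div] at h1 h2
    have h3 : xb / x ≤ xb / x' := by gcongr
    have h4 : y / yb ≤ y' / yb := by gcongr
    rw [hz, Real.log_mul (by positivity) (by positivity)]
    linarith
  have hmul := mul_le_mul_of_nonneg_left hlogz (div_pos hxb hs).le
  have hsurrogate : xb / (xb + yb) * (2 - xb / x' - y' / yb) =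
      2 * xb / (xb + yb) - (xb ^ 2 / (xb + yb)) / x' - (xb / ((xb + yb) * yb)) * y' := by
    field_simp
  linarith
end

section
/- Let x, y, x̄, ȳ be positive real numbers and define Â = ln(1 + x̄/ȳ) − x̄/(x̄+ȳ), B̂ = ȳ/(x̄+ȳ), and Ĉ = 1/x̄. If x'' and y'' are real numbers with x ≤ x'' and 0 < y'' ≤ y, then ln(1 + x/y) ≤ Â + (1/2)·B̂·(Ĉ·x''²/y'' + (1/Ĉ)·(1/y'')). In particular, replacing the numerator of the SINR by any upper bound and the denominator by any positive lower bound preserves the convex upper bound of the rate. -/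
/-- Tangent-line bound for `u ↦ log (1 + u)` at `t`. -/
theorem log_one_add_le_tangent {u t : ℝ} (hu : 0 < 1 + u) (ht : 0 < 1 + t) :
    Real.log (1 + u) ≤ Real.log (1 + t) + (u - t) / (1 + t) := by
  have h := Real.log_le_sub_one_of_pos (div_pos hu ht)
  rw [Real.log_div hu.ne' ht.ne'] at h
  have e : (1 + u) / (1 + t) - 1 = (u - t) / (1 + t) := by
    field_simp
    ring
  linarith

/-- Weighted arithmetic-geometric mean bound for a ratio. -/
theorem div_le_half_weighted_sq_add {a b c : ℝ} (hb : 0 < b) (hc : 0 < c) :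
    a / b ≤ 1 / 2 * ((1 / c) * a ^ 2 / b + (1 / (1 / c)) * (1 / b)) := by
  have e : 1 / 2 * ((1 / c) * a ^ 2 / b + (1 / (1 / c)) * (1 / b)) - a / b =
      (a - c) ^ 2 / (2 * b * c) := by
    field_simp
    ring
  have : 0 ≤ (a - c) ^ 2 / (2 * b * c) := by positivity
  linarith

/-- composite rate upper bound. With `Â = ln(1 + x̄/ȳ) − x̄/(x̄+ȳ)`,
`B̂ = ȳ/(x̄+ȳ)`, `Ĉ = 1/x̄`, if `x ≤ x''` and `0 < y'' ≤ y`, then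
`ln(1 + x/y) ≤ Â + (1/2)·B̂·(Ĉ·x''²/y'' + (1/Ĉ)·(1/y''))`. -/
theorem composite_rate_upper_bound (x y xb yb x'' y'' : ℝ)
    (hx : 0 < x) (hy : 0 < y) (hxb : 0 < xb) (hyb : 0 < yb)
    (hxx'' : x ≤ x'') (hy'' : 0 < y'') (hy''y : y'' ≤ y) :
    Real.log (1 + x / y) ≤
      (Real.log (1 + xb / yb) - xb / (xb + yb)) +
        (1 / 2) * (yb / (xb + yb)) *
          ((1 / xb) * x'' ^ 2 / y'' + (1 / (1 / xb)) * (1 / y'')) := by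
  have hratio : x / y ≤ x'' / y'' :=
    div_le_div₀ (hx.le.trans hxx'') hxx'' hy'' hy''y
  have htangent : Real.log (1 + x / y) ≤
      Real.log (1 + xb / yb) + (x / y - xb / yb) / (1 + xb / yb) :=
    log_one_add_le_tangent (by positivity) (by positivity)
  have hslope : (x / y - xb / yb) / (1 + xb / yb) =
      yb / (xb + yb) * (x / y) - xb / (xb + yb) := by
    field_simp
    ring
  have hsurrogate := mul_le_mul_of_nonneg_left
    (hratio.trans (div_le_half_weighted_sq_add hy'' hxb))
    (show 0 ≤ yb / (xb + yb) by positivity)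
  linarith
end
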